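/- arXiv:1807.08996 — 4 statements merged into one kernel-verified Lean document; each statement's English description precedes it below -/
import Mathlib

section
/- Let (a₁, …, aₙ) be an n-tuple of real symmetric 3×3 matrices. Then the family is monoclinic — i.e. some g ∈ SO(3) with g² = 1 and g ≠ 1 satisfies g aₖ gᵀ = aₖ for all k, but there is no h ∈ SO(3) such that hᵀ·aₖ·h is diagonal for every k — if and only if there exist indices i, j such that the axial vector ω := ((aᵢaⱼ−aⱼaᵢ)₂₃, (aᵢaⱼ−aⱼaᵢ)₃₁, (aᵢaⱼ−aⱼaᵢ)₁₂) ∈ ℝ³ is nonzero (i.e. tr(aᵢ × aⱼ) ≠ 0) and, for every index k, the ordinary cross product (aₖ·ω) ×₃ ω in ℝ³ vanishes (i.e. ω is an eigenvector of every aₖ). -/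
open Matrix

/-- The rotation group `SO(3)` as a set of real `3 × 3` matrices. -/
def SO3 : Set (Matrix (Fin 3) (Fin 3) ℝ) := {g | g * gᵀ = 1 ∧ g.det = 1}

/-- The axial vector `ω(a,b) = ((ab−ba)₂₃, (ab−ba)₃₁, (ab−ba)₁₂)` of the commutator of `a`
and `b` (zero-based indices); up to a nonzero constant it equals `tr(a × b)`. -/
def axialVec (a b : Matrix (Fin 3) (Fin 3) ℝ) : Fin 3 → ℝ :=
  ![(a * b - b * a) 1 2, (a * b - b * a) 2 0, (a * b - b * a) 0 1]

open Module.End in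
/-- A commuting family of real symmetric matrices is simultaneously diagonalized by an orthogonal
matrix. -/
theorem exists_orthogonal_isDiag_of_commute {ι : Type*} {m : ℕ}
    (a : ι → Matrix (Fin m) (Fin m) ℝ) (ha : ∀ k, (a k)ᵀ = a k)
    (hc : ∀ i j, a i * a j = a j * a i) :
    ∃ h : Matrix (Fin m) (Fin m) ℝ, h * hᵀ = 1 ∧ ∀ k, (hᵀ * a k * h).IsDiag := by
  classical
  let T : ι → EuclideanSpace ℝ (Fin m) →ₗ[ℝ] EuclideanSpace ℝ (Fin m) :=
    fun k => (a k).toEuclideanLin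
  have hT : ∀ k, (T k).IsSymmetric := fun k =>
    Matrix.isSymmetric_toEuclideanLin_iff.mpr (by
      rw [Matrix.IsHermitian, conjTranspose_eq_transpose_of_trivial, ha k])
  have hC : Pairwise (Function.onFun Commute T) := by
    intro i j _
    refine LinearMap.ext fun x => ?_
    ext l
    simp [T, Matrix.toLpLin_apply, Matrix.mulVec_mulVec, hc i j]
  have hV := LinearMap.IsSymmetric.directSum_isInternal_of_pairwise_commute hT hC
  have hO := LinearMap.IsSymmetric.orthogonalFamily_iInf_eigenspaces hT
  have : Finite {χ : ι → ℝ // (⨅ j, eigenspace (T j) (χ j)) ≠ ⊥} :=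
    WellFoundedGT.finite_ne_bot_of_iSupIndep hV.submodule_iSupIndep
  have := Fintype.ofFinite {χ : ι → ℝ // (⨅ j, eigenspace (T j) (χ j)) ≠ ⊥}
  have hV' := DirectSum.isInternal_ne_bot_iff.mpr hV
  have hO' := hO.comp (Subtype.val_injective
    (p := fun χ : ι → ℝ => (⨅ j, eigenspace (T j) (χ j)) ≠ ⊥))
  have hn : Module.finrank ℝ (EuclideanSpace ℝ (Fin m)) = m := finrank_euclideanSpace_fin
  let b := hV'.subordinateOrthonormalBasis hn hO'
  have hb : ∀ i k, ∃ μ : ℝ, (a k) *ᵥ (b i).ofLp = μ • (b i).ofLp := by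
    intro i k
    have h1 := hV'.subordinateOrthonormalBasis_subordinate hn i hO'
    have h2 := mem_eigenspace_iff.mp ((Submodule.mem_iInf _).mp h1 k)
    exact ⟨_, congrArg WithLp.ofLp h2⟩
  have ho : ∀ i j, (b i).ofLp ⬝ᵥ (b j).ofLp = if i = j then 1 else 0 := by
    intro i j
    have := orthonormal_iff_ite.mp b.orthonormal i j
    rw [← this, EuclideanSpace.inner_eq_star_dotProduct, star_trivial, dotProduct_comm]
  let h : Matrix (Fin m) (Fin m) ℝ := (Matrix.of fun i => (b i).ofLp)ᵀ
  refine ⟨h, mul_eq_one_comm.mp ?_, fun k i j hij => ?_⟩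
  · ext i j
    rw [Matrix.one_apply, ← ho i j]
    rfl
  · obtain ⟨μ, hμ⟩ := hb j k
    have : (hᵀ * a k * h) i j = (b i).ofLp ⬝ᵥ (a k *ᵥ (b j).ofLp) := by
      rw [Matrix.mul_assoc]
      rfl
    rw [this, hμ, dotProduct_smul, ho, if_neg hij, smul_zero]

/-- A commuting family of real symmetric `3 × 3` matrices is simultaneously diagonalized by a
rotation. -/
theorem exists_mem_SO3_isDiag_of_commute {ι : Type*} (a : ι → Matrix (Fin 3) (Fin 3) ℝ)
    (ha : ∀ k, (a k)ᵀ = a k) (hc : ∀ i j, a i * a j = a j * a i) :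
    ∃ h ∈ SO3, ∀ k, (hᵀ * a k * h).IsDiag := by
  obtain ⟨h, h1, h2⟩ := exists_orthogonal_isDiag_of_commute a ha hc
  have hd : h.det * h.det = 1 := by
    have := congrArg det h1
    rwa [det_mul, det_transpose, det_one] at this
  rcases mul_self_eq_one_iff.mp hd with hd | hd
  · exact ⟨h, ⟨h1, hd⟩, h2⟩
  · refine ⟨-h, ⟨by simpa using h1, ?_⟩, fun k => by simpa using h2 k⟩
    rw [det_neg, hd]
    norm_num

theorem axialVec_eq_zero_iff {a b : Matrix (Fin 3) (Fin 3) ℝ} (ha : aᵀ = a) (hb : bᵀ = b) :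
    axialVec a b = 0 ↔ a * b = b * a := by
  constructor
  · intro h
    have hs : (a * b - b * a)ᵀ = -(a * b - b * a) := by
      rw [transpose_sub, transpose_mul, transpose_mul, ha, hb, neg_sub]
    have h0 : (a * b - b * a) 1 2 = 0 := congrFun h 0
    have h1 : (a * b - b * a) 2 0 = 0 := congrFun h 1
    have h2 : (a * b - b * a) 0 1 = 0 := congrFun h 2
    rw [← sub_eq_zero]
    generalize a * b - b * a = c at *
    have hc : ∀ i j, c j i = -c i j := fun i j => congrFun (congrFun hs i) j
    ext i j
    have := hc i j
    have := hc i i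
    fin_cases i <;> fin_cases j <;> simp at * <;> linarith
  · intro h
    ext i
    fin_cases i <;> simp [axialVec, h]

theorem transpose_adjugate_of_mem_SO3 {g : Matrix (Fin 3) (Fin 3) ℝ} (hg : g ∈ SO3) :
    g.adjugateᵀ = g := by
  have h : g.adjugate = gᵀ := by
    calc g.adjugate = g.adjugate * (g * gᵀ) := by rw [hg.1, Matrix.mul_one]
      _ = gᵀ := by rw [← Matrix.mul_assoc, adjugate_mul, hg.2, one_smul, Matrix.one_mul]
  rw [h, transpose_transpose]

theorem cross_mulVec_mulVec (g : Matrix (Fin 3) (Fin 3) ℝ) (x y : Fin 3 → ℝ) :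
    crossProduct (g *ᵥ x) (g *ᵥ y) = g.adjugateᵀ *ᵥ crossProduct x y := by
  rw [adjugate_fin_three]
  ext i
  fin_cases i <;>
    simp [cross_apply, mulVec, dotProduct, Fin.sum_univ_three] <;> ring

/-- Rotations act on axial vectors as on ordinary vectors. -/
theorem axialVec_conj {g : Matrix (Fin 3) (Fin 3) ℝ} (hg : g ∈ SO3)
    {a b : Matrix (Fin 3) (Fin 3) ℝ} (ha : aᵀ = a) (hb : bᵀ = b) :
    axialVec (g * a * gᵀ) (g * b * gᵀ) = g *ᵥ axialVec a b := by
  have hg' : gᵀ * g = 1 := mul_eq_one_comm.mp hg.1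
  have hmul : ∀ x y : Matrix (Fin 3) (Fin 3) ℝ, g * x * gᵀ * (g * y * gᵀ) = g * (x * y) * gᵀ := by
    intro x y
    calc g * x * gᵀ * (g * y * gᵀ) = g * x * (gᵀ * g) * y * gᵀ := by simp only [Matrix.mul_assoc]
      _ = g * (x * y) * gᵀ := by rw [hg', Matrix.mul_one, Matrix.mul_assoc g x y]
  have hs : (a * b - b * a)ᵀ = -(a * b - b * a) := by
    rw [transpose_sub, transpose_mul, transpose_mul, ha, hb, neg_sub]
  have hadj := transpose_adjugate_of_mem_SO3 hg
  conv_rhs => rw [← hadj, adjugate_fin_three]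
  unfold axialVec
  rw [hmul, hmul, ← Matrix.sub_mul, ← Matrix.mul_sub]
  generalize a * b - b * a = c at *
  have hc : ∀ i j, c j i = -c i j := fun i j => congrFun (congrFun hs i) j
  have h0 : c 0 0 = 0 := by linarith [hc 0 0]
  have h1 : c 1 1 = 0 := by linarith [hc 1 1]
  have h2 : c 2 2 = 0 := by linarith [hc 2 2]
  ext i
  fin_cases i <;>
    simp [mul_apply, mulVec, dotProduct, Fin.sum_univ_three, h0, h1, h2, hc 0 1, hc 2 0, hc 1 2] <;>
    ring

/-- The axis of a nontrivial rotation is one-dimensional. -/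
theorem cross_eq_zero_of_fixed {g : Matrix (Fin 3) (Fin 3) ℝ} (hg : g ∈ SO3) (hg1 : g ≠ 1)
    {x y : Fin 3 → ℝ} (hx : g *ᵥ x = x) (hy : g *ᵥ y = y) : crossProduct x y = 0 := by
  by_contra hz
  set z := crossProduct x y with hzdef
  have hgz : g *ᵥ z = z := by
    have := cross_mulVec_mulVec g x y
    rw [hx, hy, transpose_adjugate_of_mem_SO3 hg] at this
    exact this.symm
  let M : Matrix (Fin 3) (Fin 3) ℝ := ![z, x, y]
  have hdet : M.det ≠ 0 := by
    rw [← triple_product_eq_det, ← hzdef]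
    exact fun h => hz (dotProduct_self_eq_zero.mp h)
  have hM : g * Mᵀ = Mᵀ := by
    ext i j
    change (g *ᵥ M j) i = M j i
    fin_cases j
    · exact congrFun hgz i
    · exact congrFun hx i
    · exact congrFun hy i
  have hu : IsUnit Mᵀ := by
    rw [isUnit_iff_isUnit_det, det_transpose]
    exact hdet.isUnit
  exact hg1 (hu.mul_right_cancel (by rw [hM, Matrix.one_mul]))

/-- The half-turn about a common eigenvector of symmetric matrices fixes all of them. -/
theorem exists_halfTurn {ι : Type*} (a : ι → Matrix (Fin 3) (Fin 3) ℝ)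
    (ha : ∀ k, (a k)ᵀ = a k) {w : Fin 3 → ℝ} (hw : w ≠ 0)
    (h : ∀ k, crossProduct (a k *ᵥ w) w = 0) :
    ∃ g ∈ SO3, g * g = 1 ∧ g ≠ 1 ∧ ∀ k, g * a k * gᵀ = a k := by
  have hs : w ⬝ᵥ w ≠ 0 := fun h0 => hw (dotProduct_self_eq_zero.mp h0)
  obtain ⟨t, ht⟩ : ∃ t : ℝ, t * (w ⬝ᵥ w) = 1 := ⟨_, inv_mul_cancel₀ hs⟩
  let P := vecMulVec w w
  let g : Matrix (Fin 3) (Fin 3) ℝ := (2 * t) • P - 1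
  have hPT : Pᵀ = P := transpose_vecMulVec w w
  have hgT : gᵀ = g := by simp [g, hPT]
  have hPP : P * P = (w ⬝ᵥ w) • P := by
    simp [P, vecMulVec_mul_vecMulVec]
  have hgg : g * g = 1 := by
    have : g * g = (4 * t * (t * (w ⬝ᵥ w) - 1)) • P + 1 := by
      simp only [g, sub_mul, mul_sub, smul_mul_assoc, mul_smul_comm, hPP, Matrix.mul_one,
        Matrix.one_mul]
      module
    rw [this, ht]
    simp
  have hdot : w ⬝ᵥ w = w 0 * w 0 + w 1 * w 1 + w 2 * w 2 := by
    simp [dotProduct, Fin.sum_univ_three]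
  rw [hdot] at ht
  refine ⟨g, ⟨by rw [hgT, hgg], ?_⟩, hgg, fun h1 => ?_, fun k => ?_⟩
  · simp only [g, P, det_fin_three, Matrix.sub_apply, Matrix.smul_apply, vecMulVec_apply,
      smul_eq_mul]
    simp
    linear_combination 2 * ht
  · have htr := congrArg trace h1
    simp only [g, P, trace_sub, trace_smul, trace_vecMulVec, hdot, trace_one, smul_eq_mul,
      Fintype.card_fin, Nat.cast_ofNat] at htr
    linarith
  · have hcomm : P * a k = a k * P := by
      obtain ⟨l, hl⟩ : ∃ l : ℝ, a k *ᵥ w = l • w := by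
        refine ⟨t * (a k *ᵥ w ⬝ᵥ w), ?_⟩
        have hk := h k
        generalize a k *ᵥ w = u at *
        have h0 : u 1 * w 2 - u 2 * w 1 = 0 := by simpa [cross_apply] using congrFun hk 0
        have h1 : u 2 * w 0 - u 0 * w 2 = 0 := by simpa [cross_apply] using congrFun hk 1
        have h2 : u 0 * w 1 - u 1 * w 0 = 0 := by simpa [cross_apply] using congrFun hk 2
        ext i
        fin_cases i <;> simp [dotProduct, Fin.sum_univ_three]
        · linear_combination (-u 0) * ht + t * w 1 * h2 - t * w 2 * h1
        · linear_combination (-u 1) * ht + t * w 2 * h0 - t * w 0 * h2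
        · linear_combination (-u 2) * ht + t * w 0 * h1 - t * w 1 * h0
      have hr : a k * P = l • P := by
        rw [mul_vecMulVec, hl, smul_vecMulVec]
      have := congrArg transpose hr
      rw [transpose_mul, transpose_smul, hPT, ha k] at this
      rw [this, hr]
    have hga : g * a k = a k * g := by
      simp only [g, sub_mul, mul_sub, smul_mul_assoc, mul_smul_comm, hcomm, Matrix.mul_one,
        Matrix.one_mul]
    rw [hgT, hga, Matrix.mul_assoc, hgg, Matrix.mul_one]

/-- Symmetric matrices that are diagonalized by one rotation commute. -/
theorem commute_of_isDiag {h a b : Matrix (Fin 3) (Fin 3) ℝ} (hh : h ∈ SO3)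
    (ha : (hᵀ * a * h).IsDiag) (hb : (hᵀ * b * h).IsDiag) : a * b = b * a := by
  have key : ∀ x y : Matrix (Fin 3) (Fin 3) ℝ,
      x * y = h * ((hᵀ * x * h) * (hᵀ * y * h)) * hᵀ := by
    intro x y
    calc x * y = (h * hᵀ) * x * (h * hᵀ) * y * (h * hᵀ) := by simp [hh.1]
      _ = _ := by simp only [Matrix.mul_assoc]
  rw [key a b, key b a, ← ha.diagonal_diag, ← hb.diagonal_diag, diagonal_mul_diagonal,
    diagonal_mul_diagonal]
  simp only [mul_comm]

/-- An `n`-tuple `(a₁, …, aₙ)` of real symmetric `3 × 3` matrices is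
monoclinic (some nontrivial rotation `g` with `g² = 1` fixes every `aₖ`, but no rotation
simultaneously diagonalizes all the `aₖ`) iff for some indices `i, j` the axial vector
`ω = ω(aᵢ, aⱼ)` is nonzero and `(aₖ·ω) ×₃ ω = 0` for every `k` (i.e. `ω` is a common
eigenvector of all the `aₖ`). -/
theorem family_monoclinic_iff
    (n : ℕ) (a : Fin n → Matrix (Fin 3) (Fin 3) ℝ) (ha : ∀ k, (a k)ᵀ = a k) :
    ((∃ g ∈ SO3, g * g = 1 ∧ g ≠ 1 ∧ ∀ k, g * a k * gᵀ = a k) ∧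
      ¬ ∃ h ∈ SO3, ∀ k, (hᵀ * a k * h).IsDiag) ↔
    (∃ i j, axialVec (a i) (a j) ≠ 0 ∧
      ∀ k, crossProduct ((a k).mulVec (axialVec (a i) (a j))) (axialVec (a i) (a j)) = 0) := by
  constructor
  · rintro ⟨⟨g, hg, -, hg1, hfix⟩, hnd⟩
    obtain ⟨i, j, hij⟩ : ∃ i j, a i * a j ≠ a j * a i := by
      by_contra! hc
      exact hnd (exists_mem_SO3_isDiag_of_commute a ha hc)
    refine ⟨i, j, fun h0 => hij ((axialVec_eq_zero_iff (ha i) (ha j)).mp h0), fun k => ?_⟩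
    have hω : g *ᵥ axialVec (a i) (a j) = axialVec (a i) (a j) := by
      rw [← axialVec_conj hg (ha i) (ha j), hfix, hfix]
    refine cross_eq_zero_of_fixed hg hg1 ?_ hω
    have hga : g * a k = a k * g := by
      calc g * a k = g * a k * (gᵀ * g) := by rw [mul_eq_one_comm.mp hg.1, Matrix.mul_one]
        _ = a k * g := by rw [← Matrix.mul_assoc, hfix]
    rw [mulVec_mulVec, hga, ← mulVec_mulVec, hω]
  · rintro ⟨i, j, hω, h⟩
    refine ⟨exists_halfTurn a ha hω h, ?_⟩
    rintro ⟨r, hr, hd⟩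
    exact hω ((axialVec_eq_zero_iff (ha i) (ha j)).mpr (commute_of_isDiag hr (hd i) (hd j)))
end

section
/- Let t be a real symmetric 3×3 matrix with exactly two distinct eigenvalues (transversely isotropic) and let p be a homogeneous polynomial of degree 4 in three real variables, representing a totally symmetric fourth-order tensor S on ℝ³. Then the pair (S,t) is transversely isotropic — i.e. there exists a unit vector n ∈ ℝ³ such that every g ∈ SO(3) with g·n = n satisfies g t gᵀ = t and p(g⁻¹·x) = p(x) for all x ∈ ℝ³ — if and only if S × t = 0, that is, the polynomial x ↦ det(x, ∇p(x), t·x) is identically zero on ℝ³. -/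
open Matrix MvPolynomial

/-- Determinant of the `3 × 3` matrix with columns `u`, `v`, `w`. -/
def det3 (u v w : Fin 3 → ℝ) : ℝ := (Matrix.of fun i j => ![u, v, w] j i).det

/-- Gradient of a polynomial in three variables, evaluated at `x`. -/
noncomputable def grad (p : MvPolynomial (Fin 3) ℝ) (x : Fin 3 → ℝ) : Fin 3 → ℝ :=
  fun i => eval x (pderiv i p)

/-- The matrix of `x ↦ v × x`. -/
def crossMatrix (v : Fin 3 → ℝ) : Matrix (Fin 3) (Fin 3) ℝ :=
  !![0, -v 2, v 1; v 2, 0, -v 0; -v 1, v 0, 0]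

/-- Rodrigues' formula for the rotation of angle `θ` about the axis spanned by the unit
vector `v`. -/
noncomputable def axisRotation (v : Fin 3 → ℝ) (θ : ℝ) : Matrix (Fin 3) (Fin 3) ℝ :=
  Real.cos θ • (1 : Matrix (Fin 3) (Fin 3) ℝ) + Real.sin θ • crossMatrix v
    + (1 - Real.cos θ) • vecMulVec v v

theorem crossMatrix_mulVec (v x : Fin 3 → ℝ) : crossMatrix v *ᵥ x =
    ![v 1 * x 2 - v 2 * x 1, v 2 * x 0 - v 0 * x 2, v 0 * x 1 - v 1 * x 0] := by
  ext i
  fin_cases i <;> simp [crossMatrix, mulVec, dotProduct, Fin.sum_univ_three] <;> ring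

theorem crossMatrix_mulVec_self (v : Fin 3 → ℝ) : crossMatrix v *ᵥ v = 0 := by
  rw [crossMatrix_mulVec]
  ext i
  fin_cases i <;> simp <;> ring

theorem crossMatrix_mulVec_mulVec (v x : Fin 3 → ℝ) :
    crossMatrix v *ᵥ (crossMatrix v *ᵥ x) = (v ⬝ᵥ x) • v - (v ⬝ᵥ v) • x := by
  ext i
  fin_cases i <;> simp [-mulVec_mulVec, crossMatrix_mulVec, dotProduct, Fin.sum_univ_three] <;> ring

theorem dotProduct_self_eq_one {v : Fin 3 → ℝ} (hv : ∑ i, v i ^ 2 = 1) : v ⬝ᵥ v = 1 := by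
  rw [← hv]
  simp [dotProduct, sq]

/-- The squared triple product is the Gram determinant. -/
theorem sq_crossMatrix_mulVec_dotProduct (v x y : Fin 3 → ℝ) :
    ((crossMatrix v *ᵥ x) ⬝ᵥ y) ^ 2 = (v ⬝ᵥ v) * (x ⬝ᵥ x) * (y ⬝ᵥ y)
      + 2 * (v ⬝ᵥ x) * (v ⬝ᵥ y) * (x ⬝ᵥ y) - (v ⬝ᵥ v) * (x ⬝ᵥ y) ^ 2
      - (x ⬝ᵥ x) * (v ⬝ᵥ y) ^ 2 - (y ⬝ᵥ y) * (v ⬝ᵥ x) ^ 2 := by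
  simp [crossMatrix_mulVec, dotProduct, Fin.sum_univ_three]
  ring

/-- Expansion of `y` along `x`, `v` and `v × x`. -/
theorem smul_eq_add_crossMatrix_mulVec (v x y : Fin 3 → ℝ) :
    ((v ⬝ᵥ v) * (x ⬝ᵥ x) - (v ⬝ᵥ x) ^ 2) • y
      = ((v ⬝ᵥ v) * (x ⬝ᵥ y) - (v ⬝ᵥ x) * (v ⬝ᵥ y)) • x
        + ((x ⬝ᵥ x) * (v ⬝ᵥ y) - (v ⬝ᵥ x) * (x ⬝ᵥ y)) • v
        + ((crossMatrix v *ᵥ x) ⬝ᵥ y) • (crossMatrix v *ᵥ x) := by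
  ext i
  fin_cases i <;> simp [crossMatrix_mulVec, dotProduct, Fin.sum_univ_three] <;> ring

theorem axisRotation_mulVec (v : Fin 3 → ℝ) (θ : ℝ) (x : Fin 3 → ℝ) :
    axisRotation v θ *ᵥ x = Real.cos θ • x + Real.sin θ • (crossMatrix v *ᵥ x)
      + ((1 - Real.cos θ) * (v ⬝ᵥ x)) • v := by
  simp [axisRotation, add_mulVec, smul_mulVec, vecMulVec_mulVec, smul_smul]

theorem axisRotation_mulVec_self {v : Fin 3 → ℝ} (hv : ∑ i, v i ^ 2 = 1) (θ : ℝ) :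
    axisRotation v θ *ᵥ v = v := by
  rw [axisRotation_mulVec, crossMatrix_mulVec_self, dotProduct_self_eq_one hv]
  module

theorem axisRotation_mem_SO3 {v : Fin 3 → ℝ} (hv : ∑ i, v i ^ 2 = 1) (θ : ℝ) :
    axisRotation v θ ∈ SO3 := by
  have h := Real.sin_sq_add_cos_sq θ
  rw [Fin.sum_univ_three] at hv
  constructor
  · ext i j
    fin_cases i <;> fin_cases j <;>
      simp [axisRotation, crossMatrix, Matrix.mul_apply, Fin.sum_univ_three, vecMulVec_apply] <;>
      grind
  · simp [axisRotation, crossMatrix, det_fin_three, vecMulVec_apply]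
    grind

theorem hasDerivAt_axisRotation_mulVec {v : Fin 3 → ℝ} (hv : ∑ i, v i ^ 2 = 1)
    (x : Fin 3 → ℝ) (θ : ℝ) :
    HasDerivAt (fun r => axisRotation v r *ᵥ x) (crossMatrix v *ᵥ (axisRotation v θ *ᵥ x)) θ := by
  simp only [axisRotation_mulVec]
  have hc := Real.hasDerivAt_cos θ
  have hs := Real.hasDerivAt_sin θ
  have h := ((hc.smul_const x).add (hs.smul_const (crossMatrix v *ᵥ x))).add
    (((hc.const_sub 1).mul_const (v ⬝ᵥ x)).smul_const v)
  refine h.congr_deriv ?_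
  simp only [mulVec_add, mulVec_smul, crossMatrix_mulVec_mulVec, crossMatrix_mulVec_self,
    dotProduct_self_eq_one hv]
  module

theorem hasDerivAt_eval_comp (p : MvPolynomial (Fin 3) ℝ) {γ : ℝ → Fin 3 → ℝ}
    {γ' : Fin 3 → ℝ} {s : ℝ} (hγ : HasDerivAt γ γ' s) :
    HasDerivAt (fun r => eval (γ r) p) (grad p (γ s) ⬝ᵥ γ') s := by
  simp only [grad, dotProduct]
  induction p using MvPolynomial.induction_on with
  | C a => simpa using hasDerivAt_const s a
  | add p q hp hq =>
    simpa [add_mul, Finset.sum_add_distrib] using hp.fun_add hq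
  | mul_X p i hp =>
    simp only [map_mul, eval_X]
    refine (hp.fun_mul (hasDerivAt_pi.1 hγ i)).congr_deriv ?_
    simp only [pderiv_mul, map_add, map_mul, eval_X, add_mul, Finset.sum_add_distrib,
      Finset.sum_mul]
    congr 1
    · exact Finset.sum_congr rfl fun j _ => by ring
    · simp [pderiv_X, Pi.single_apply, apply_ite]

theorem exists_cos_sin_eq {c s : ℝ} (h : c ^ 2 + s ^ 2 = 1) :
    ∃ θ : ℝ, Real.cos θ = c ∧ Real.sin θ = s := by
  have hn : ‖(⟨c, s⟩ : ℂ)‖ = 1 := by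
    rw [Complex.norm_def, Complex.normSq_mk, ← sq, ← sq, h, Real.sqrt_one]
  refine ⟨Complex.arg ⟨c, s⟩, ?_, ?_⟩
  · rw [Complex.cos_arg (by rw [← norm_ne_zero_iff, hn]; exact one_ne_zero), hn, div_one]
  · rw [Complex.sin_arg, hn, div_one]

theorem exists_axisRotation_mulVec_eq {v : Fin 3 → ℝ} (hv : ∑ i, v i ^ 2 = 1)
    {x y : Fin 3 → ℝ} (hn : x ⬝ᵥ x = y ⬝ᵥ y) (hd : v ⬝ᵥ x = v ⬝ᵥ y) :
    ∃ θ, axisRotation v θ *ᵥ x = y := by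
  have hvv := dotProduct_self_eq_one hv
  have hgram := sq_crossMatrix_mulVec_dotProduct v x y
  have hy := smul_eq_add_crossMatrix_mulVec v x y
  rw [hvv, ← hn, ← hd] at hgram
  rw [hvv, ← hd] at hy
  by_cases hr : x ⬝ᵥ x = (v ⬝ᵥ x) ^ 2
  · have haxis {z : Fin 3 → ℝ} (hz : z ⬝ᵥ z = (v ⬝ᵥ z) ^ 2) : z = (v ⬝ᵥ z) • v := by
      rw [← sub_eq_zero, ← dotProduct_self_eq_zero]
      simp only [sub_dotProduct, dotProduct_sub, smul_dotProduct, dotProduct_smul, hvv, hz,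
        dotProduct_comm z v, smul_eq_mul]
      ring
    refine ⟨0, ?_⟩
    rw [haxis (z := y) (by rw [← hn, ← hd, hr]), ← hd, ← haxis hr]
    simp [axisRotation]
  replace hr := sub_ne_zero.2 hr
  obtain ⟨θ, hc, hs⟩ := exists_cos_sin_eq
    (c := (x ⬝ᵥ y - (v ⬝ᵥ x) ^ 2) / (x ⬝ᵥ x - (v ⬝ᵥ x) ^ 2))
    (s := ((crossMatrix v *ᵥ x) ⬝ᵥ y) / (x ⬝ᵥ x - (v ⬝ᵥ x) ^ 2)) (by
      rw [div_pow, div_pow, ← add_div, div_eq_one_iff_eq (pow_ne_zero 2 hr), hgram]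
      ring)
  refine ⟨θ, smul_right_injective _ hr ?_⟩
  simp only [axisRotation_mulVec, hc, hs]
  rw [← one_mul (x ⬝ᵥ x), hy]
  ext i
  simp only [Pi.add_apply, Pi.smul_apply, smul_eq_mul]
  field_simp
  ring

theorem conj_smul_one_add_smul_vecMulVec {g : Matrix (Fin 3) (Fin 3) ℝ} (hg : g * gᵀ = 1)
    (a b : ℝ) (n : Fin 3 → ℝ) :
    g * (a • (1 : Matrix (Fin 3) (Fin 3) ℝ) + b • vecMulVec n n) * gᵀ
      = a • (1 : Matrix (Fin 3) (Fin 3) ℝ) + b • vecMulVec (g *ᵥ n) (g *ᵥ n) := by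
  rw [mul_add, add_mul, Matrix.mul_smul, Matrix.smul_mul, mul_one, hg, Matrix.mul_smul,
    Matrix.smul_mul, mul_vecMulVec, vecMulVec_mul, vecMul_transpose]

/-- A symmetric `3 × 3` matrix with exactly two eigenvalues is a scalar matrix plus a nonzero
multiple of a rank-one projection. -/
theorem exists_eq_smul_one_add_smul_vecMulVec {t : Matrix (Fin 3) (Fin 3) ℝ} (ht : tᵀ = t)
    (h2 : (spectrum ℝ t).ncard = 2) :
    ∃ (a b : ℝ) (n : Fin 3 → ℝ), b ≠ 0 ∧ ∑ i, n i ^ 2 = 1 ∧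
      t = a • (1 : Matrix (Fin 3) (Fin 3) ℝ) + b • vecMulVec n n := by
  have hA : t.IsHermitian := by simpa [IsHermitian] using ht
  rw [hA.spectrum_real_eq_range_eigenvalues] at h2
  set l := hA.eigenvalues
  obtain ⟨a, k, hk, ha⟩ : ∃ a k, l k ≠ a ∧ ∀ i, i ≠ k → l i = a := by
    obtain ⟨x, y, hxy, h⟩ := Set.ncard_eq_two.1 h2
    have hl (i) : l i = x ∨ l i = y := by simpa [h] using Set.mem_range_self (f := l) i
    obtain ⟨i, hi⟩ : x ∈ Set.range l := by simp [h]
    obtain ⟨j, hj⟩ : y ∈ Set.range l := by simp [h]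
    simp only [Fin.exists_fin_succ, Fin.forall_fin_succ]
    by_contra!
    have hl0 := hl 0
    have hl1 := hl 1
    have hl2 := hl 2
    fin_cases i <;> fin_cases j <;> grind
  set U := (hA.eigenvectorUnitary : Matrix (Fin 3) (Fin 3) ℝ)
  have hU : U * Uᵀ = 1 := Unitary.mul_star_self_of_mem hA.eigenvectorUnitary.2
  have hU' : Uᵀ * U = 1 := Unitary.star_mul_self_of_mem hA.eigenvectorUnitary.2
  have h3 : t = U * diagonal l * Uᵀ := hA.spectral_theorem
  have hl : diagonal l = a • (1 : Matrix (Fin 3) (Fin 3) ℝ)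
      + (l k - a) • vecMulVec (Pi.single k 1) (Pi.single k 1) := by
    ext i j
    by_cases hik : i = k <;> by_cases hij : i = j <;>
      simp_all [vecMulVec_apply, Pi.single_apply]
  refine ⟨a, l k - a, fun i => U i k, sub_ne_zero.2 hk, ?_, ?_⟩
  · simpa [Matrix.mul_apply, sq] using congrFun (congrFun hU' k) k
  · conv_lhs => rw [h3, hl]
    rw [conj_smul_one_add_smul_vecMulVec hU, mulVec_single_one]
    rfl

theorem det3_smul_one_add_smul_vecMulVec (a b : ℝ) (n x w : Fin 3 → ℝ) :
    det3 x w ((a • (1 : Matrix (Fin 3) (Fin 3) ℝ) + b • vecMulVec n n) *ᵥ x)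
      = b * (n ⬝ᵥ x) * (w ⬝ᵥ (crossMatrix n *ᵥ x)) := by
  simp [det3, det_fin_three, crossMatrix, add_mulVec, smul_mulVec, vecMulVec_mulVec, mulVec,
    dotProduct, Fin.sum_univ_three]
  ring

/-- If the quarter turn about `v` fixes the line spanned by `n`, then `n` is parallel to `v`. -/
theorem eq_smul_of_vecMulVec_axisRotation {v n : Fin 3 → ℝ} (hv : ∑ i, v i ^ 2 = 1)
    (h : vecMulVec (axisRotation v (Real.pi / 2) *ᵥ n) (axisRotation v (Real.pi / 2) *ᵥ n)
      = vecMulVec n n) : n = (v ⬝ᵥ n) • v := by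
  set w := crossMatrix v *ᵥ n with hw
  have hR : axisRotation v (Real.pi / 2) *ᵥ n = w + (v ⬝ᵥ n) • v := by
    simp [axisRotation_mulVec, hw]
  have hwn : w ⬝ᵥ n = 0 := by
    simp [hw, crossMatrix_mulVec, dotProduct, Fin.sum_univ_three]; ring
  have hwv : w ⬝ᵥ v = 0 := by
    simp [hw, crossMatrix_mulVec, dotProduct, Fin.sum_univ_three]; ring
  have h' := congrArg (fun M => w ⬝ᵥ (M *ᵥ w)) h
  simp only [hR, vecMulVec_mulVec, dotProduct_smul, add_dotProduct, smul_dotProduct,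
    dotProduct_add, hwn, hwv, dotProduct_comm v w, dotProduct_comm n w] at h'
  have hw0 : w = 0 := by simpa using h'
  have h2 := crossMatrix_mulVec_mulVec v n
  rw [← hw, hw0, mulVec_zero, dotProduct_self_eq_one hv, one_smul] at h2
  exact (sub_eq_zero.1 h2.symm).symm

theorem grad_dotProduct_crossMatrix_eq_zero {p : MvPolynomial (Fin 3) ℝ} {v : Fin 3 → ℝ}
    (hv : ∑ i, v i ^ 2 = 1) {x : Fin 3 → ℝ}
    (h : ∀ θ, eval (axisRotation v θ *ᵥ x) p = eval x p) :
    grad p x ⬝ᵥ (crossMatrix v *ᵥ x) = 0 := by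
  have hd := hasDerivAt_eval_comp p (hasDerivAt_axisRotation_mulVec hv x 0)
  have h0 : axisRotation v 0 *ᵥ x = x := by simp [axisRotation]
  simp only [h, h0] at hd
  exact hd.unique (hasDerivAt_const 0 _)

theorem eval_axisRotation_mulVec {p : MvPolynomial (Fin 3) ℝ} {v : Fin 3 → ℝ}
    (hv : ∑ i, v i ^ 2 = 1) (h : ∀ x, grad p x ⬝ᵥ (crossMatrix v *ᵥ x) = 0)
    (θ : ℝ) (x : Fin 3 → ℝ) : eval (axisRotation v θ *ᵥ x) p = eval x p := by
  have hd (s : ℝ) : HasDerivAt (fun r => eval (axisRotation v r *ᵥ x) p) 0 s := by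
    simpa only [h] using hasDerivAt_eval_comp p (hasDerivAt_axisRotation_mulVec hv x s)
  have := is_const_of_deriv_eq_zero (fun s => (hd s).differentiableAt) (fun s => (hd s).deriv) θ 0
  simpa [axisRotation] using this

theorem continuous_grad (p : MvPolynomial (Fin 3) ℝ) : Continuous (grad p) :=
  continuous_pi fun i => (pderiv i p).continuous_eval

theorem grad_dotProduct_crossMatrix_eq_zero_of_mul {p : MvPolynomial (Fin 3) ℝ} {n : Fin 3 → ℝ}
    (hn : ∑ i, n i ^ 2 = 1)
    (h : ∀ x, (n ⬝ᵥ x) * (grad p x ⬝ᵥ (crossMatrix n *ᵥ x)) = 0) (x : Fin 3 → ℝ) :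
    grad p x ⬝ᵥ (crossMatrix n *ᵥ x) = 0 := by
  by_cases hx : n ⬝ᵥ x = 0
  · have hnn := dotProduct_self_eq_one hn
    have hc : Continuous fun ε : ℝ =>
        grad p (x + ε • n) ⬝ᵥ (crossMatrix n *ᵥ (x + ε • n)) := by
      have := continuous_grad p
      fun_prop
    have h0 := Continuous.ext_on (dense_compl_singleton (0 : ℝ)) hc continuous_const
      (g := fun _ => 0) fun ε (hε : ε ≠ 0) => by simpa [hx, hnn, hε] using h (x + ε • n)
    simpa using congrFun h0 0
  · exact (mul_eq_zero.1 (h x)).resolve_left hx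

/-- Let `t` be a transversely isotropic real symmetric `3 × 3` matrix
(exactly two distinct eigenvalues) and `p` a homogeneous degree-4 polynomial representing a
totally symmetric fourth-order tensor `S`. The pair `(S, t)` is transversely isotropic
(some unit vector `n` is such that every rotation fixing `n` fixes both `t` and `p`)
iff `S × t = 0`, i.e. the polynomial `x ↦ det(x, ∇p(x), t·x)` vanishes identically. -/
theorem symmetric_tensor_pair_transversely_isotropic_iff
    (t : Matrix (Fin 3) (Fin 3) ℝ) (ht : tᵀ = t) (h2 : (spectrum ℝ t).ncard = 2)
    (p : MvPolynomial (Fin 3) ℝ) (hp : p.IsHomogeneous 4) :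
    (∃ v : Fin 3 → ℝ, (∑ i, v i ^ 2) = 1 ∧
        ∀ g ∈ SO3, g.mulVec v = v →
          g * t * gᵀ = t ∧ ∀ x : Fin 3 → ℝ, eval (g⁻¹.mulVec x) p = eval x p) ↔
      ∀ x : Fin 3 → ℝ, det3 x (grad p x) (t.mulVec x) = 0 := by
  obtain ⟨a, b, n, hb, hn, rfl⟩ := exists_eq_smul_one_add_smul_vecMulVec ht h2
  simp only [det3_smul_one_add_smul_vecMulVec]
  constructor
  · rintro ⟨v, hv, hinv⟩ x
    have hR (θ : ℝ) := hinv _ (axisRotation_mem_SO3 hv θ) (axisRotation_mulVec_self hv θ)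
    have hnv : n = (v ⬝ᵥ n) • v := by
      refine eq_smul_of_vecMulVec_axisRotation hv ?_
      have h := (hR (Real.pi / 2)).1
      rw [conj_smul_one_add_smul_vecMulVec (axisRotation_mem_SO3 hv _).1] at h
      exact smul_right_injective _ hb (add_left_cancel h)
    have hp' := grad_dotProduct_crossMatrix_eq_zero (p := p) (x := x) hv fun θ => by
      have hu : IsUnit (axisRotation v θ).det := by simp [(axisRotation_mem_SO3 hv θ).2]
      rw [← (hR θ).2, mulVec_mulVec, nonsing_inv_mul _ hu, one_mulVec]
    have hK : crossMatrix n = (v ⬝ᵥ n) • crossMatrix v := by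
      conv_lhs => rw [hnv]
      ext i j
      fin_cases i <;> fin_cases j <;> simp [crossMatrix]
    rw [hK, smul_mulVec, dotProduct_smul, hp', smul_zero, mul_zero]
  · intro h
    have hp' := grad_dotProduct_crossMatrix_eq_zero_of_mul (p := p) hn fun x => by
      simpa [hb, mul_assoc] using h x
    refine ⟨n, hn, fun g hg hgn => ⟨?_, fun x => ?_⟩⟩
    · rw [conj_smul_one_add_smul_vecMulVec hg.1, hgn]
    · have hg' : gᵀ * g = 1 := mul_eq_one_comm.1 hg.1
      obtain ⟨θ, hθ⟩ := exists_axisRotation_mulVec_eq hn (x := x) (y := gᵀ *ᵥ x)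
        (by rw [dotProduct_mulVec, vecMul_transpose, mulVec_mulVec, hg.1, one_mulVec])
        (by rw [dotProduct_mulVec, vecMul_transpose, hgn])
      rw [inv_eq_right_inv hg.1, ← hθ, eval_axisRotation_mulVec hn hp']
end

section
/- Let t be a real symmetric 3×3 matrix with exactly two distinct eigenvalues (transversely isotropic) and let p be a harmonic homogeneous polynomial of degree 4 in three real variables (Δp = 0), representing a fourth-order harmonic tensor H on ℝ³. Then the pair (H,t) is at least tetragonal — i.e. there exists g ∈ SO(3) with g⁴ = 1 and g² ≠ 1 (a rotation of order four) such that g t gᵀ = t and p(g⁻¹·x) = p(x) for all x — if and only if tr(H × t) = 0, that is, the Laplacian of the quintic polynomial x ↦ det(x, ∇p(x), t·x) is the zero polynomial. -/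
open Matrix MvPolynomial

/-- The Laplacian of a polynomial in three variables. -/
noncomputable def lap (p : MvPolynomial (Fin 3) ℝ) : MvPolynomial (Fin 3) ℝ :=
  ∑ i, pderiv i (pderiv i p)

/-- The polynomial `x ↦ det(x, ∇p(x), t·x)`, i.e. the determinant of the matrix with
columns `X`, `∇p`, `t·X` over the polynomial ring. -/
noncomputable def detPoly (p : MvPolynomial (Fin 3) ℝ) (t : Matrix (Fin 3) (Fin 3) ℝ) :
    MvPolynomial (Fin 3) ℝ :=
  (Matrix.of fun i j =>
    ![(fun k => (X k : MvPolynomial (Fin 3) ℝ)),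
      (fun k => pderiv k p),
      (fun k => ∑ l, C (t k l) * X l)] j i).det

lemma pderiv_ofNat (i : Fin 3) (n : ℕ) [n.AtLeastTwo] :
    pderiv i (ofNat(n) : MvPolynomial (Fin 3) ℝ) = 0 :=
  (pderiv i).map_natCast n

lemma pderiv_pderiv_comm (i j : Fin 3) (p : MvPolynomial (Fin 3) ℝ) :
    pderiv i (pderiv j p) = pderiv j (pderiv i p) := by
  induction p using MvPolynomial.induction_on with
  | C a => simp
  | add p q hp hq => simp [hp, hq]
  | mul_X p k hp =>
    have h : ∀ i j : Fin 3, pderiv i (pderiv j (X k : MvPolynomial (Fin 3) ℝ)) = 0 := fun i j => by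
      rw [pderiv_X, Pi.single_apply]
      split_ifs <;> simp
    simp only [Derivation.leibniz, smul_eq_mul, map_add, hp, h]
    ring

/-- A homogeneous polynomial of positive degree lies in the ideal of the variables, with homogeneous
cofactors. -/
lemma exists_eq_X_mul_of_isHomogeneous_succ {n : ℕ} {p : MvPolynomial (Fin 3) ℝ}
    (hp : p.IsHomogeneous (n + 1)) :
    ∃ q : Fin 3 → MvPolynomial (Fin 3) ℝ, (∀ i, (q i).IsHomogeneous n) ∧
      p = X 0 * q 0 + X 1 * q 1 + X 2 * q 2 := by
  refine ⟨fun i => C ((n + 1 : ℝ)⁻¹) * pderiv i p, fun i => ?_, ?_⟩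
  · simpa using (isHomogeneous_C (Fin 3) ((n + 1 : ℝ)⁻¹)).mul (hp.pderiv (i := i))
  · have h := hp.sum_X_mul_pderiv
    rw [Fin.sum_univ_three] at h
    have hC : (C ((n + 1 : ℝ)⁻¹) : MvPolynomial (Fin 3) ℝ) * ((n + 1 : ℕ) : MvPolynomial (Fin 3) ℝ)
        = 1 := by
      rw [← C_eq_coe_nat, ← C_mul, ← C_1]
      congr 1
      push_cast
      exact inv_mul_cancel₀ (by positivity)
    rw [nsmul_eq_mul] at h
    linear_combination (-p) * hC - C ((n + 1 : ℝ)⁻¹) * h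

lemma exists_eq_C_of_isHomogeneous_zero {p : MvPolynomial (Fin 3) ℝ} (hp : p.IsHomogeneous 0) :
    ∃ a, p = C a :=
  ⟨_, totalDegree_eq_zero_iff_eq_C.1 ((totalDegree_zero_iff_isHomogeneous _).2 hp)⟩

lemma exists_eq_linear {p : MvPolynomial (Fin 3) ℝ} (hp : p.IsHomogeneous 1) :
    ∃ c : Fin 3 → ℝ, p = C (c 0) * X 0 + C (c 1) * X 1 + C (c 2) * X 2 := by
  obtain ⟨q, hq, rfl⟩ := exists_eq_X_mul_of_isHomogeneous_succ hp
  choose c hc using fun i => exists_eq_C_of_isHomogeneous_zero (hq i)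
  refine ⟨c, ?_⟩
  simp only [hc]
  ring

lemma exists_eq_quadratic {p : MvPolynomial (Fin 3) ℝ} (hp : p.IsHomogeneous 2) :
    ∃ c : Fin 6 → ℝ, p = C (c 0) * X 0 ^ 2 + C (c 1) * X 1 ^ 2 + C (c 2) * X 2 ^ 2 +
      C (c 3) * (X 0 * X 1) + C (c 4) * (X 0 * X 2) + C (c 5) * (X 1 * X 2) := by
  obtain ⟨q, hq, rfl⟩ := exists_eq_X_mul_of_isHomogeneous_succ hp
  choose c hc using fun i => exists_eq_linear (hq i)
  refine ⟨![c 0 0, c 1 1, c 2 2, c 0 1 + c 1 0, c 0 2 + c 2 0, c 1 2 + c 2 1], ?_⟩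
  simp only [hc 0, hc 1, hc 2, Matrix.cons_val, C_add]
  ring

lemma exists_eq_cubic {p : MvPolynomial (Fin 3) ℝ} (hp : p.IsHomogeneous 3) :
    ∃ c : Fin 10 → ℝ, p = C (c 0) * X 0 ^ 3 + C (c 1) * X 1 ^ 3 + C (c 2) * X 2 ^ 3 +
      C (c 3) * (X 0 ^ 2 * X 1) + C (c 4) * (X 0 ^ 2 * X 2) + C (c 5) * (X 1 ^ 2 * X 0) +
      C (c 6) * (X 1 ^ 2 * X 2) + C (c 7) * (X 2 ^ 2 * X 0) + C (c 8) * (X 2 ^ 2 * X 1) +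
      C (c 9) * (X 0 * X 1 * X 2) := by
  obtain ⟨q, hq, rfl⟩ := exists_eq_X_mul_of_isHomogeneous_succ hp
  choose c hc using fun i => exists_eq_quadratic (hq i)
  refine ⟨![c 0 0, c 1 1, c 2 2, c 0 3 + c 1 0, c 0 4 + c 2 0, c 1 3 + c 0 1, c 1 5 + c 2 1,
    c 2 4 + c 0 2, c 2 5 + c 1 2, c 0 5 + c 1 4 + c 2 3], ?_⟩
  simp only [hc 0, hc 1, hc 2, Matrix.cons_val, C_add]
  ring

/-- The general ternary quartic form with coefficients `c`. -/
noncomputable def quartic (c : Fin 15 → ℝ) : MvPolynomial (Fin 3) ℝ :=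
  C (c 0) * X 0 ^ 4 + C (c 1) * X 1 ^ 4 + C (c 2) * X 2 ^ 4 +
    C (c 3) * (X 0 ^ 3 * X 1) + C (c 4) * (X 0 ^ 3 * X 2) + C (c 5) * (X 1 ^ 3 * X 0) +
    C (c 6) * (X 1 ^ 3 * X 2) + C (c 7) * (X 2 ^ 3 * X 0) + C (c 8) * (X 2 ^ 3 * X 1) +
    C (c 9) * (X 0 ^ 2 * X 1 ^ 2) + C (c 10) * (X 0 ^ 2 * X 2 ^ 2) +
    C (c 11) * (X 1 ^ 2 * X 2 ^ 2) + C (c 12) * (X 0 ^ 2 * X 1 * X 2) +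
    C (c 13) * (X 0 * X 1 ^ 2 * X 2) + C (c 14) * (X 0 * X 1 * X 2 ^ 2)

lemma exists_eq_quartic {p : MvPolynomial (Fin 3) ℝ} (hp : p.IsHomogeneous 4) :
    ∃ c, p = quartic c := by
  obtain ⟨q, hq, rfl⟩ := exists_eq_X_mul_of_isHomogeneous_succ hp
  choose c hc using fun i => exists_eq_cubic (hq i)
  refine ⟨![c 0 0, c 1 1, c 2 2, c 0 3 + c 1 0, c 0 4 + c 2 0, c 1 5 + c 0 1, c 1 6 + c 2 1,
    c 2 7 + c 0 2, c 2 8 + c 1 2, c 0 5 + c 1 3, c 0 7 + c 2 4, c 1 8 + c 2 6,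
    c 0 9 + c 1 4 + c 2 3, c 0 6 + c 1 9 + c 2 5, c 0 8 + c 1 7 + c 2 9], ?_⟩
  simp only [hc 0, hc 1, hc 2, quartic, Matrix.cons_val, C_add]
  ring

lemma eval_quartic (c : Fin 15 → ℝ) (x y z : ℝ) :
    eval ![x, y, z] (quartic c) =
      c 0 * x ^ 4 + c 1 * y ^ 4 + c 2 * z ^ 4 + c 3 * (x ^ 3 * y) + c 4 * (x ^ 3 * z) +
      c 5 * (y ^ 3 * x) + c 6 * (y ^ 3 * z) + c 7 * (z ^ 3 * x) + c 8 * (z ^ 3 * y) +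
      c 9 * (x ^ 2 * y ^ 2) + c 10 * (x ^ 2 * z ^ 2) + c 11 * (y ^ 2 * z ^ 2) +
      c 12 * (x ^ 2 * y * z) + c 13 * (x * y ^ 2 * z) + c 14 * (x * y * z ^ 2) := by
  simp [quartic]

lemma eval_lap_quartic (c : Fin 15 → ℝ) (x y z : ℝ) :
    eval ![x, y, z] (lap (quartic c)) =
      (12 * c 0 + 2 * c 9 + 2 * c 10) * x ^ 2 + (12 * c 1 + 2 * c 9 + 2 * c 11) * y ^ 2 +
      (12 * c 2 + 2 * c 10 + 2 * c 11) * z ^ 2 + (6 * c 3 + 6 * c 5 + 2 * c 14) * (x * y) +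
      (6 * c 4 + 6 * c 7 + 2 * c 13) * (x * z) + (6 * c 6 + 6 * c 8 + 2 * c 12) * (y * z) := by
  simp [quartic, lap, Fin.sum_univ_three, pderiv_X, Derivation.leibniz, Derivation.leibniz_pow,
    pderiv_ofNat, Pi.single_apply]
  ring

lemma lap_quartic_eq_zero {c : Fin 15 → ℝ} (h : lap (quartic c) = 0) :
    12 * c 0 + 2 * c 9 + 2 * c 10 = 0 ∧ 12 * c 1 + 2 * c 9 + 2 * c 11 = 0 ∧
      12 * c 2 + 2 * c 10 + 2 * c 11 = 0 ∧ 6 * c 3 + 6 * c 5 + 2 * c 14 = 0 ∧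
      6 * c 4 + 6 * c 7 + 2 * c 13 = 0 ∧ 6 * c 6 + 6 * c 8 + 2 * c 12 = 0 := by
  have H := fun x y z => (eval_lap_quartic c x y z).symm.trans (by rw [h, map_zero])
  have h1 := H 1 0 0
  have h2 := H 0 1 0
  have h3 := H 0 0 1
  have h4 := H 1 1 0
  have h5 := H 1 0 1
  have h6 := H 0 1 1
  refine ⟨?_, ?_, ?_, ?_, ?_, ?_⟩ <;> linarith

/-- `∂_z (x ∂_y q - y ∂_x q)` is, up to a factor, the Laplacian of `det(x, ∇q, t x)` for
`t = diag(a, a, b)`. -/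
lemma lap_detPoly_diagonal (a b : ℝ) {q : MvPolynomial (Fin 3) ℝ} (h : lap q = 0) :
    lap (detPoly q (diagonal ![a, a, b])) =
      C (2 * (b - a)) * pderiv 2 (X 0 * pderiv 1 q - X 1 * pderiv 0 q) := by
  have hdet : detPoly q (diagonal ![a, a, b]) =
      C (b - a) * (X 2 * (X 0 * pderiv 1 q - X 1 * pderiv 0 q)) := by
    simp [detPoly, det_fin_three, Fin.sum_univ_three, diagonal_apply]
    ring
  have h0 := congrArg (pderiv 0) h
  have h1 := congrArg (pderiv 1) h
  have hC : (C 2 : MvPolynomial (Fin 3) ℝ) = 2 := map_ofNat C 2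
  rw [hdet]
  simp only [lap, Fin.sum_univ_three, map_add, map_zero] at h0 h1 ⊢
  simp [pderiv_X, Derivation.leibniz, hC]
  rw [pderiv_pderiv_comm 0 1 (pderiv 1 q), pderiv_pderiv_comm 0 1 q,
    pderiv_pderiv_comm 0 2 (pderiv 2 q), pderiv_pderiv_comm 0 2 q] at h0
  rw [pderiv_pderiv_comm 1 0 (pderiv 0 q), pderiv_pderiv_comm 1 0 q,
    pderiv_pderiv_comm 1 2 (pderiv 2 q), pderiv_pderiv_comm 1 2 q] at h1
  rw [pderiv_pderiv_comm 1 0 q] at h0 ⊢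
  linear_combination (C b - C a) * X 2 * (X 0 * h1 - X 1 * h0)

lemma eval_pderiv_rotation_quartic (c : Fin 15 → ℝ) (x y z : ℝ) :
    eval ![x, y, z] (pderiv 2 (X 0 * pderiv 1 (quartic c) - X 1 * pderiv 0 (quartic c))) =
      c 12 * x ^ 3 - c 13 * y ^ 3 + 3 * (c 8 * x - c 7 * y) * z ^ 2 +
      (2 * c 13 - 3 * c 4) * (x ^ 2 * y) + (3 * c 6 - 2 * c 12) * (x * y ^ 2) +
      2 * c 14 * (x ^ 2 - y ^ 2) * z + 4 * (c 11 - c 10) * (x * y * z) := by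
  simp [quartic, pderiv_X, Derivation.leibniz, Derivation.leibniz_pow, pderiv_ofNat]
  ring

/-- A harmonic quartic `q` with `∂_z (x ∂_y q - y ∂_x q) = 0` is invariant under the rotation of
order four about the third axis. -/
lemma quartic_rotation_invariant {c : Fin 15 → ℝ} (hh : lap (quartic c) = 0)
    (h : pderiv 2 (X 0 * pderiv 1 (quartic c) - X 1 * pderiv 0 (quartic c)) = 0) (x y z : ℝ) :
    eval ![y, -x, z] (quartic c) = eval ![x, y, z] (quartic c) := by
  obtain ⟨l0, l1, l2, l3, l4, l5⟩ := lap_quartic_eq_zero hh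
  have H := fun x y z => (eval_pderiv_rotation_quartic c x y z).symm.trans (by rw [h, map_zero])
  have h1 := H 1 0 0
  have h2 := H 0 1 0
  have h3 := H 1 0 1
  have h4 := H 0 1 1
  have h5 := H 1 1 0
  have h6 := H 1 (-1) 0
  have h7 := H 1 1 1
  have h8 := H 1 0 (-1)
  have e12 : c 12 = 0 := by linarith
  have e13 : c 13 = 0 := by linarith
  have e14 : c 14 = 0 := by linarith
  have e8 : c 8 = 0 := by linarith
  have e7 : c 7 = 0 := by linarith
  have e4 : c 4 = 0 := by linarith
  have e6 : c 6 = 0 := by linarith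
  have e11 : c 11 = c 10 := by linarith
  have e5 : c 5 = -c 3 := by linarith
  have e1 : c 1 = c 0 := by linarith
  rw [eval_quartic, eval_quartic, e12, e13, e14, e8, e7, e4, e6, e11, e5, e1]
  ring

/-- The converse of `quartic_rotation_invariant`, for either rotation of order four. -/
lemma pderiv_rotation_eq_zero_of_invariant {c : Fin 15 → ℝ} (hh : lap (quartic c) = 0) {s : ℝ}
    (hs : s ^ 2 = 1)
    (h : ∀ x y z, eval ![s * y, -s * x, z] (quartic c) = eval ![x, y, z] (quartic c)) :
    pderiv 2 (X 0 * pderiv 1 (quartic c) - X 1 * pderiv 0 (quartic c)) = 0 := by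
  obtain ⟨l0, l1, l2, l3, l4, l5⟩ := lap_quartic_eq_zero hh
  have h' : ∀ x y z, eval ![-x, -y, z] (quartic c) = eval ![x, y, z] (quartic c) := fun x y z => by
    rw [← h x y z, ← h (s * y) (-s * x) z, show s * (-s * x) = -x by linear_combination -x * hs,
      show -s * (s * y) = -y by linear_combination -y * hs]
  simp only [eval_quartic] at h h'
  have a1 := h' 1 0 1
  have a2 := h' 1 0 2
  have a3 := h' 0 1 1
  have a4 := h' 0 1 2
  have a5 := h' 1 1 1
  have a6 := h' 1 (-1) 1
  have e4 : c 4 = 0 := by linarith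
  have e7 : c 7 = 0 := by linarith
  have e6 : c 6 = 0 := by linarith
  have e8 : c 8 = 0 := by linarith
  have e12 : c 12 = 0 := by linarith
  have e13 : c 13 = 0 := by linarith
  have h2 : ∀ x y z, c 0 * y ^ 4 + c 1 * x ^ 4 + c 2 * z ^ 4 - c 3 * (y ^ 3 * x) -
      c 5 * (x ^ 3 * y) + c 9 * (x ^ 2 * y ^ 2) + c 10 * (y ^ 2 * z ^ 2) +
      c 11 * (x ^ 2 * z ^ 2) - c 14 * (x * y * z ^ 2) =
      c 0 * x ^ 4 + c 1 * y ^ 4 + c 2 * z ^ 4 + c 3 * (x ^ 3 * y) + c 5 * (y ^ 3 * x) +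
      c 9 * (x ^ 2 * y ^ 2) + c 10 * (x ^ 2 * z ^ 2) + c 11 * (y ^ 2 * z ^ 2) +
      c 14 * (x * y * z ^ 2) := fun x y z => by
    have := h x y z
    have hs4 : s ^ 4 = 1 := by rw [show s ^ 4 = (s ^ 2) ^ 2 by ring, hs]; norm_num
    have hs3 : s ^ 3 * s = 1 := by rw [← hs4]; ring
    rw [e4, e7, e6, e8, e12, e13] at this
    linear_combination this + (-c 0 * y ^ 4 - c 1 * x ^ 4 + c 3 * y ^ 3 * x + c 5 * x ^ 3 * y -
      c 9 * x ^ 2 * y ^ 2) * hs4 + (-c 10 * y ^ 2 * z ^ 2 - c 11 * x ^ 2 * z ^ 2 +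
      c 14 * x * y * z ^ 2) * hs
  have b1 := h2 1 0 0
  have b2 := h2 1 0 1
  have b3 := h2 1 1 0
  have b4 := h2 1 1 1
  have e11 : c 11 = c 10 := by linarith
  have e14 : c 14 = 0 := by linarith
  refine MvPolynomial.funext fun v => ?_
  rw [show v = ![v 0, v 1, v 2] by ext i; fin_cases i <;> rfl, eval_pderiv_rotation_quartic,
    e12, e13, e14, e8, e7, e4, e6, e11]
  simp

/-- A rotation of order four commuting with `diag(a, a, b)` is a quarter turn about the third
axis. -/
lemma exists_eq_quarter_turn {a b : ℝ} (hab : a ≠ b) {g : Matrix (Fin 3) (Fin 3) ℝ}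
    (hg : g ∈ SO3) (h4 : g ^ 4 = 1) (h2 : g ^ 2 ≠ 1)
    (hD : g * diagonal ![a, a, b] * gᵀ = diagonal ![a, a, b]) :
    ∃ s : ℝ, s ^ 2 = 1 ∧ g = !![0, -s, 0; s, 0, 0; 0, 0, 1] := by
  obtain ⟨ho, hdet⟩ := hg
  have ho' : gᵀ * g = 1 := mul_eq_one_comm.1 ho
  have hc : g * diagonal ![a, a, b] = diagonal ![a, a, b] * g := by
    rw [← hD, Matrix.mul_assoc (g * _), ho', Matrix.mul_one, hD]
  have hab' : b - a ≠ 0 := sub_ne_zero.2 hab.symm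
  have z02 : g 0 2 = 0 := by
    have := congrFun₂ hc 0 2
    simp only [mul_diagonal, diagonal_mul, Matrix.cons_val] at this
    exact (mul_eq_zero.1 (show (b - a) * g 0 2 = 0 by linarith)).resolve_left hab'
  have z12 : g 1 2 = 0 := by
    have := congrFun₂ hc 1 2
    simp only [mul_diagonal, diagonal_mul, Matrix.cons_val] at this
    exact (mul_eq_zero.1 (show (b - a) * g 1 2 = 0 by linarith)).resolve_left hab'
  have z20 : g 2 0 = 0 := by
    have := congrFun₂ hc 2 0
    simp only [mul_diagonal, diagonal_mul, Matrix.cons_val] at this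
    exact (mul_eq_zero.1 (show (b - a) * g 2 0 = 0 by linarith)).resolve_left hab'
  have z21 : g 2 1 = 0 := by
    have := congrFun₂ hc 2 1
    simp only [mul_diagonal, diagonal_mul, Matrix.cons_val] at this
    exact (mul_eq_zero.1 (show (b - a) * g 2 1 = 0 by linarith)).resolve_left hab'
  obtain ⟨p, q, r, s, w, rfl⟩ : ∃ p q r s w, g = !![p, q, 0; r, s, 0; 0, 0, w] :=
    ⟨g 0 0, g 0 1, g 1 0, g 1 1, g 2 2, by
      ext i j; fin_cases i <;> fin_cases j <;> simp [z02, z12, z20, z21]⟩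
  have o00 := congrFun₂ ho 0 0
  have o01 := congrFun₂ ho 0 1
  have o11 := congrFun₂ ho 1 1
  have o22 := congrFun₂ ho 2 2
  simp [Matrix.mul_apply, Fin.sum_univ_three] at o00 o01 o11 o22
  simp [det_fin_three] at hdet
  have hne : ¬ (p * p + q * r = 1 ∧ p * q + q * s = 0 ∧ r * p + s * r = 0 ∧ r * q + s * s = 1) := by
    rintro ⟨e1, e2, e3, e4⟩
    refine h2 ?_
    ext i j
    fin_cases i <;> fin_cases j <;> simp [sq, Matrix.mul_apply, Fin.sum_univ_three, *]
  have hw : w = 1 := by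
    rcases mul_self_eq_one_iff.1 o22 with h | h
    · exact h
    · exfalso
      subst h
      have hs : s = -p := by linear_combination -s * o00 - p * hdet + q * o01
      have hr : r = q := by linear_combination -r * o00 + q * hdet + p * o01
      subst hs hr
      exact hne ⟨by linarith, by ring, by ring, by linarith⟩
  subst hw
  have hs : s = p := by linear_combination -s * o00 + p * hdet + q * o01
  have hr : r = -q := by linear_combination -r * o00 - q * hdet + p * o01
  subst hs hr
  have h22 : ∀ i j, (!![s, q, 0; -q, s, 0; 0, 0, 1] ^ 2 * !![s, q, 0; -q, s, 0; 0, 0, 1] ^ 2 :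
      Matrix (Fin 3) (Fin 3) ℝ) i j = (1 : Matrix (Fin 3) (Fin 3) ℝ) i j := by
    rw [← pow_add, h4]
    exact fun _ _ => rfl
  have f00 := h22 0 0
  have f01 := h22 0 1
  simp [sq, Matrix.mul_apply, Fin.sum_univ_three] at f00 f01
  have hsq : s * q = 0 := by
    by_contra hne'
    have : (s * q) ^ 2 = 0 := by nlinarith
    exact hne' (by simpa using this)
  have hs0 : s = 0 := by
    rcases mul_eq_zero.1 hsq with h | h
    · exact h
    · subst h
      exact absurd ⟨by linarith, by ring, by ring, by linarith⟩ hne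
  subst hs0
  refine ⟨-q, by linarith, ?_⟩
  simp

/-- The theorem in the eigenbasis of `t`. -/
lemma tetragonal_diagonal_iff {a b : ℝ} (hab : a ≠ b) {q : MvPolynomial (Fin 3) ℝ}
    (hq : q.IsHomogeneous 4) (hharm : lap q = 0) :
    (∃ g ∈ SO3, g ^ 4 = 1 ∧ g ^ 2 ≠ 1 ∧
        g * diagonal ![a, a, b] * gᵀ = diagonal ![a, a, b] ∧
        ∀ x : Fin 3 → ℝ, eval (g⁻¹.mulVec x) q = eval x q) ↔
      lap (detPoly q (diagonal ![a, a, b])) = 0 := by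
  obtain ⟨c, rfl⟩ := exists_eq_quartic hq
  have hab' : (C (2 * (b - a)) : MvPolynomial (Fin 3) ℝ) ≠ 0 := by
    simpa [sub_eq_zero] using hab.symm
  have hmul : ∀ s x y z : ℝ, (!![0, -s, 0; s, 0, 0; 0, 0, 1]ᵀ : Matrix (Fin 3) (Fin 3) ℝ).mulVec
      ![x, y, z] = ![s * y, -s * x, z] := fun s x y z => by
    ext i
    fin_cases i <;> simp [mulVec, dotProduct, Fin.sum_univ_three]
  rw [lap_detPoly_diagonal a b hharm, mul_eq_zero, or_iff_right hab']
  constructor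
  · rintro ⟨g, hg, h4, h2, hD, hinv⟩
    rw [inv_eq_right_inv hg.1] at hinv
    obtain ⟨s, hs, rfl⟩ := exists_eq_quarter_turn hab hg h4 h2 hD
    refine pderiv_rotation_eq_zero_of_invariant hharm hs fun x y z => ?_
    rw [← hmul, hinv]
  · intro h
    have ho : (!![0, -1, 0; 1, 0, 0; 0, 0, 1] * !![0, -1, 0; 1, 0, 0; 0, 0, 1]ᵀ :
        Matrix (Fin 3) (Fin 3) ℝ) = 1 := by
      ext i j
      fin_cases i <;> fin_cases j <;> simp [Matrix.mul_apply, Fin.sum_univ_three]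
    have hsq : (!![0, -1, 0; 1, 0, 0; 0, 0, 1] ^ 2 : Matrix (Fin 3) (Fin 3) ℝ) =
        diagonal ![-1, -1, 1] := by
      ext i j
      fin_cases i <;> fin_cases j <;> simp [sq, Matrix.mul_apply, Fin.sum_univ_three]
    refine ⟨!![0, -1, 0; 1, 0, 0; 0, 0, 1], ⟨ho, ?_⟩, ?_, ?_, ?_, fun x => ?_⟩
    · simp [det_fin_three]
    · rw [show 4 = 2 * 2 from rfl, pow_mul, hsq, diagonal_pow, ← diagonal_one]
      congr 1
      ext i
      fin_cases i <;> simp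
    · intro h1
      have := congrFun₂ (hsq.symm.trans h1) 0 0
      norm_num at this
    · ext i j
      fin_cases i <;> fin_cases j <;>
        simp [Matrix.mul_apply, Fin.sum_univ_three, diagonal_apply, vecMul, dotProduct]
    · rw [inv_eq_right_inv ho, show x = ![x 0, x 1, x 2] by ext i; fin_cases i <;> rfl, hmul]
      simpa using quartic_rotation_invariant hharm h (x 0) (x 1) (x 2)

/-- The linear substitution `p ↦ p(R x)`. -/
noncomputable def linearSubst (R : Matrix (Fin 3) (Fin 3) ℝ) :
    MvPolynomial (Fin 3) ℝ →ₐ[ℝ] MvPolynomial (Fin 3) ℝ :=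
  aeval fun i => ∑ j, C (R i j) * X j

lemma linearSubst_X (R : Matrix (Fin 3) (Fin 3) ℝ) (i : Fin 3) :
    linearSubst R (X i) = ∑ j, C (R i j) * X j :=
  aeval_X _ _

lemma eval_linearSubst (R : Matrix (Fin 3) (Fin 3) ℝ) (p : MvPolynomial (Fin 3) ℝ)
    (x : Fin 3 → ℝ) : eval x (linearSubst R p) = eval (R.mulVec x) p := by
  induction p using MvPolynomial.induction_on with
  | C a => simp
  | add p q hp hq => simp [hp, hq]
  | mul_X p k hp => simp [hp, linearSubst_X, mulVec, dotProduct]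

lemma linearSubst_eq_zero_iff {R : Matrix (Fin 3) (Fin 3) ℝ} (hR : R * Rᵀ = 1)
    (p : MvPolynomial (Fin 3) ℝ) : linearSubst R p = 0 ↔ p = 0 := by
  refine ⟨fun h => MvPolynomial.funext fun x => ?_, fun h => by rw [h, map_zero]⟩
  have := eval_linearSubst R p (Rᵀ.mulVec x)
  rwa [h, mulVec_mulVec, hR, one_mulVec, map_zero, eq_comm] at this

lemma pderiv_linearSubst (R : Matrix (Fin 3) (Fin 3) ℝ) (i : Fin 3) (p : MvPolynomial (Fin 3) ℝ) :
    pderiv i (linearSubst R p) = ∑ k, C (R k i) * linearSubst R (pderiv k p) := by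
  induction p using MvPolynomial.induction_on with
  | C a => simp
  | add p q hp hq => simp [hp, hq, mul_add, Finset.sum_add_distrib]
  | mul_X p k hp =>
    have hX : pderiv i (linearSubst R (X k)) = C (R k i) := by
      simp [linearSubst_X, Derivation.leibniz, pderiv_X, Pi.single_apply]
    have hk : ∑ l, C (R l i) * linearSubst R (pderiv l (X k)) = C (R k i) := by
      simp [pderiv_X, Pi.single_apply, apply_ite]
    simp only [map_mul, Derivation.leibniz, smul_eq_mul, hp, hX, map_add, mul_add,
      Finset.sum_add_distrib]
    rw [← hk, Finset.mul_sum, Finset.mul_sum]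
    simp only [mul_left_comm]

lemma lap_linearSubst {R : Matrix (Fin 3) (Fin 3) ℝ} (hR : R * Rᵀ = 1)
    (p : MvPolynomial (Fin 3) ℝ) : lap (linearSubst R p) = linearSubst R (lap p) := by
  have hC : ∀ k l, ∑ i, C (R k i) * C (R l i) =
      (C ((1 : Matrix (Fin 3) (Fin 3) ℝ) k l) : MvPolynomial (Fin 3) ℝ) := fun k l => by
    rw [← hR, Matrix.mul_apply, map_sum]
    simp
  calc lap (linearSubst R p)
      = ∑ i, ∑ k, ∑ l, C (R k i) * C (R l i) * linearSubst R (pderiv l (pderiv k p)) := by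
        simp [lap, pderiv_linearSubst, Derivation.leibniz, Finset.mul_sum, mul_assoc]
    _ = ∑ k, ∑ l, (∑ i, C (R k i) * C (R l i)) * linearSubst R (pderiv l (pderiv k p)) := by
        rw [Finset.sum_comm]
        refine Finset.sum_congr rfl fun k _ => ?_
        rw [Finset.sum_comm]
        exact Finset.sum_congr rfl fun l _ => (Finset.sum_mul ..).symm
    _ = linearSubst R (lap p) := by
        simp [hC, lap, Matrix.one_apply, apply_ite]

lemma isHomogeneous_linearSubst (R : Matrix (Fin 3) (Fin 3) ℝ) {p : MvPolynomial (Fin 3) ℝ} {n : ℕ}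
    (hp : p.IsHomogeneous n) : (linearSubst R p).IsHomogeneous n := by
  have := hp.aeval (fun i => ∑ j, C (R i j) * X j : Fin 3 → MvPolynomial (Fin 3) ℝ) (n := 1)
    fun i => IsHomogeneous.sum _ _ _ fun j _ => isHomogeneous_C_mul_X _ _
  simpa [linearSubst] using this

lemma detPoly_linearSubst {R : Matrix (Fin 3) (Fin 3) ℝ} (hR : R ∈ SO3)
    (p : MvPolynomial (Fin 3) ℝ) (t : Matrix (Fin 3) (Fin 3) ℝ) :
    detPoly (linearSubst R p) (Rᵀ * t * R) = linearSubst R (detPoly p t) := by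
  have ho : Rᵀ * R = 1 := mul_eq_one_comm.1 hR.1
  have hdet : ((Rᵀ).map (C : ℝ → MvPolynomial (Fin 3) ℝ)).det = 1 := by
    have := RingHom.map_det (C : ℝ →+* MvPolynomial (Fin 3) ℝ) Rᵀ
    rw [det_transpose, hR.2, map_one] at this
    exact this.symm
  have hX : ∀ i, (X i : MvPolynomial (Fin 3) ℝ) = ∑ k, C (R k i) * ∑ j, C (R k j) * X j :=
    fun i => by
      have := fun j => congrArg (C : ℝ → MvPolynomial (Fin 3) ℝ) (congrFun₂ ho i j)
      simp only [Matrix.mul_apply, transpose_apply, map_sum, map_mul] at this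
      simp only [Finset.mul_sum, ← mul_assoc]
      rw [Finset.sum_comm]
      simp only [← Finset.sum_mul, this]
      simp [Matrix.one_apply, apply_ite]
  have hT : ∀ i, (∑ l, C ((Rᵀ * t * R) i l) * X l : MvPolynomial (Fin 3) ℝ) =
      ∑ k, C (R k i) * ∑ l, C (t k l) * ∑ j, C (R l j) * X j := fun i => by
    simp only [Matrix.mul_apply, transpose_apply, Fin.sum_univ_three, C_add, C_mul]
    ring
  unfold detPoly
  rw [AlgHom.map_det]
  conv_rhs => rw [← one_mul (det _), ← hdet, ← det_mul]
  congr 1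
  ext1 i j
  rw [Matrix.mul_apply]
  fin_cases j
  · simpa [linearSubst_X] using hX i
  · simpa using pderiv_linearSubst R i p
  · simpa [linearSubst_X] using hT i

/-- Tetragonality is preserved by a rotation of the frame. -/
lemma tetragonal_linearSubst {R : Matrix (Fin 3) (Fin 3) ℝ} (hR : R ∈ SO3)
    {t : Matrix (Fin 3) (Fin 3) ℝ} {p : MvPolynomial (Fin 3) ℝ}
    (h : ∃ g ∈ SO3, g ^ 4 = 1 ∧ g ^ 2 ≠ 1 ∧ g * t * gᵀ = t ∧
        ∀ x : Fin 3 → ℝ, eval (g⁻¹.mulVec x) p = eval x p) :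
    ∃ g ∈ SO3, g ^ 4 = 1 ∧ g ^ 2 ≠ 1 ∧ g * (Rᵀ * t * R) * gᵀ = Rᵀ * t * R ∧
        ∀ x : Fin 3 → ℝ, eval (g⁻¹.mulVec x) (linearSubst R p) = eval x (linearSubst R p) := by
  obtain ⟨g, hg, h4, h2, ht, hp⟩ := h
  have hR1 : R * Rᵀ = 1 := hR.1
  have hR2 : Rᵀ * R = 1 := mul_eq_one_comm.1 hR1
  have c1 : ∀ A : Matrix (Fin 3) (Fin 3) ℝ, R * (Rᵀ * A) = A := fun A => by
    rw [← Matrix.mul_assoc, hR1, Matrix.one_mul]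
  have c2 : ∀ A : Matrix (Fin 3) (Fin 3) ℝ, Rᵀ * (R * A) = A := fun A => by
    rw [← Matrix.mul_assoc, hR2, Matrix.one_mul]
  have c3 : ∀ A : Matrix (Fin 3) (Fin 3) ℝ, g * (gᵀ * A) = A := fun A => by
    rw [← Matrix.mul_assoc, hg.1, Matrix.one_mul]
  have hsq : (Rᵀ * g * R) ^ 2 = Rᵀ * g ^ 2 * R := by
    simp only [sq, Matrix.mul_assoc, c1]
  have ho : (Rᵀ * g * R) * (Rᵀ * g * R)ᵀ = 1 := by
    simp only [transpose_mul, transpose_transpose, Matrix.mul_assoc, c1, c3, hR2]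
  refine ⟨Rᵀ * g * R, ⟨ho, ?_⟩, ?_, fun h => h2 ?_, ?_, fun x => ?_⟩
  · simp [hR.2, hg.2]
  · rw [show 4 = 2 * 2 from rfl, pow_mul, hsq, sq]
    have : Rᵀ * g ^ 2 * R * (Rᵀ * g ^ 2 * R) = Rᵀ * (g ^ 2 * g ^ 2) * R := by
      simp only [Matrix.mul_assoc, c1]
    rw [this, ← pow_add, h4, Matrix.mul_one, hR2]
  · rw [hsq] at h
    have := congrArg (fun A => R * A * Rᵀ) h
    simpa only [Matrix.mul_assoc, c1, hR1, Matrix.mul_one] using this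
  · conv_rhs => rw [← ht]
    simp only [transpose_mul, transpose_transpose, Matrix.mul_assoc, c1]
  · rw [eval_linearSubst, eval_linearSubst, inv_eq_right_inv ho, ← hp (R.mulVec x),
      inv_eq_right_inv hg.1, mulVec_mulVec, mulVec_mulVec]
    simp only [transpose_mul, transpose_transpose, Matrix.mul_assoc, c1]

/-- A symmetric matrix with two distinct eigenvalues is `diag(a, a, b)` in some rotated frame. -/
lemma exists_rotation_eq_diagonal {t : Matrix (Fin 3) (Fin 3) ℝ} (ht : tᵀ = t)
    (h2 : (spectrum ℝ t).ncard = 2) :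
    ∃ R ∈ SO3, ∃ a b : ℝ, a ≠ b ∧ Rᵀ * t * R = diagonal ![a, a, b] := by
  have hH : t.IsHermitian := by simpa [IsHermitian, conjTranspose_eq_transpose_of_trivial] using ht
  rw [hH.spectrum_real_eq_range_eigenvalues] at h2
  obtain ⟨σ, hσ1, hσ2⟩ : ∃ σ : Equiv.Perm (Fin 3),
      hH.eigenvalues (σ 0) = hH.eigenvalues (σ 1) ∧ hH.eigenvalues (σ 1) ≠ hH.eigenvalues (σ 2) := by
    generalize hH.eigenvalues = e at h2
    have hr : Set.range e = {e 0, e 1, e 2} := by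
      ext y
      simp [Fin.exists_fin_succ, eq_comm]
    rw [hr] at h2
    by_cases h01 : e 0 = e 1
    · refine ⟨1, by simpa using h01, fun h => ?_⟩
      simp only [Equiv.Perm.coe_one, id] at h
      simp [h01, h] at h2
    · by_cases h12 : e 1 = e 2
      · exact ⟨Equiv.swap 0 2, by simpa [Equiv.swap_apply_def] using h12.symm,
          by simpa [Equiv.swap_apply_def] using Ne.symm h01⟩
      · by_cases h02 : e 0 = e 2
        · exact ⟨Equiv.swap 1 2, by simpa [Equiv.swap_apply_def] using h02,
            by simpa [Equiv.swap_apply_def] using Ne.symm h12⟩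
        · rw [Set.ncard_eq_three.2 ⟨_, _, _, h01, h02, h12, rfl⟩] at h2
          omega
  set U : Matrix (Fin 3) (Fin 3) ℝ := (hH.eigenvectorUnitary : Matrix (Fin 3) (Fin 3) ℝ) with hU
  have hUU : Uᵀ * U = 1 := by
    have := Unitary.coe_star_mul_self hH.eigenvectorUnitary
    rwa [star_eq_conjTranspose, conjTranspose_eq_transpose_of_trivial] at this
  have hUt : Uᵀ * t * U = diagonal hH.eigenvalues := by
    have := hH.conjStarAlgAut_star_eigenvectorUnitary
    simpa [Unitary.conjStarAlgAut_apply, star_eq_conjTranspose,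
      conjTranspose_eq_transpose_of_trivial, Function.comp_def] using this
  set V := U.submatrix id σ with hV
  have hsub : ∀ A : Matrix (Fin 3) (Fin 3) ℝ, Vᵀ * A * V = (Uᵀ * A * U).submatrix σ σ := fun A => by
    ext i j
    simp [hV, Matrix.mul_apply]
  have hVV : Vᵀ * V = 1 := by
    simpa [hUU] using hsub 1
  have hVt : Vᵀ * t * V =
      diagonal ![hH.eigenvalues (σ 1), hH.eigenvalues (σ 1), hH.eigenvalues (σ 2)] := by
    rw [hsub, hUt, submatrix_diagonal _ _ σ.injective]
    congr 1
    ext i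
    fin_cases i <;> simp [hσ1]
  have hd : V.det = 1 ∨ V.det = -1 := by
    have := congrArg det hVV
    rw [det_mul, det_transpose, det_one] at this
    exact mul_self_eq_one_iff.1 this
  rcases hd with hd | hd
  · exact ⟨V, ⟨mul_eq_one_comm.1 hVV, hd⟩, _, _, hσ2, hVt⟩
  · refine ⟨-V, ⟨?_, ?_⟩, _, _, hσ2, by simpa using hVt⟩
    · simpa using mul_eq_one_comm.1 hVV
    · rw [det_neg, hd]
      norm_num

/-- Let `t` be a transversely isotropic real symmetric `3 × 3` matrix
(exactly two distinct eigenvalues) and `p` a harmonic homogeneous degree-4 polynomial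
representing a fourth-order harmonic tensor `H`. The pair `(H, t)` is at least tetragonal
(some rotation `g` of order four fixes both `t` and `p`) iff `tr(H × t) = 0`, i.e. the
Laplacian of the quintic `x ↦ det(x, ∇p(x), t·x)` is the zero polynomial. -/
theorem harmonic_pair_at_least_tetragonal_iff
    (t : Matrix (Fin 3) (Fin 3) ℝ) (ht : tᵀ = t) (h2 : (spectrum ℝ t).ncard = 2)
    (p : MvPolynomial (Fin 3) ℝ) (hp : p.IsHomogeneous 4) (hharm : lap p = 0) :
    (∃ g ∈ SO3, g ^ 4 = 1 ∧ g ^ 2 ≠ 1 ∧ g * t * gᵀ = t ∧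
        ∀ x : Fin 3 → ℝ, eval (g⁻¹.mulVec x) p = eval x p) ↔
      lap (detPoly p t) = 0 := by
  obtain ⟨R, hR, a, b, hab, hD⟩ := exists_rotation_eq_diagonal ht h2
  have hR1 : R * Rᵀ = 1 := hR.1
  have hR2 : Rᵀ * R = 1 := mul_eq_one_comm.1 hR1
  have hRT : Rᵀ ∈ SO3 := ⟨by rwa [transpose_transpose], by rw [det_transpose, hR.2]⟩
  have hback : linearSubst Rᵀ (linearSubst R p) = p := MvPolynomial.funext fun x => by
    rw [eval_linearSubst, eval_linearSubst, mulVec_mulVec, hR1, one_mulVec]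
  have htback : Rᵀᵀ * (Rᵀ * t * R) * Rᵀ = t := by
    rw [transpose_transpose, Matrix.mul_assoc, Matrix.mul_assoc (Rᵀ * t), hR1, Matrix.mul_one,
      ← Matrix.mul_assoc, hR1, Matrix.one_mul]
  have key := tetragonal_diagonal_iff hab (isHomogeneous_linearSubst R hp)
    (by rw [lap_linearSubst hR1, hharm, map_zero])
  rw [← hD, detPoly_linearSubst hR, lap_linearSubst hR1, linearSubst_eq_zero_iff hR1] at key
  rw [← key]
  refine ⟨tetragonal_linearSubst hR, fun h => ?_⟩
  have := tetragonal_linearSubst hRT h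
  rwa [hback, htback] at this
end

section
/- Let E = (H, a, b, λ, μ) be the harmonic decomposition of an elasticity tensor, where H is represented by a harmonic homogeneous degree-4 polynomial p in three real variables (Δp = 0), a and b are traceless real symmetric 3×3 matrices, and λ, μ are real scalars; the symmetry group of E is the joint stabilizer {g ∈ SO(3) : g ⋆ p = p, g a gᵀ = a, g b gᵀ = b}. Then E is isotropic — i.e. every g ∈ SO(3) satisfies g ⋆ p = p, g a gᵀ = a and g b gᵀ = b — if and only if a = 0, b = 0 and d₂(p) = 0, where d₂(p) is the symmetric matrix with entries d₂(p)ᵢⱼ = Σ_{k,l,m} (∂ₖ∂ₗ∂ₘ∂ᵢ p)·(∂ₖ∂ₗ∂ₘ∂ⱼ p) (realizing d₂ = tr₁₃(H²) up to a positive factor; d₂(p) = 0 is equivalent to p = 0). -/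
open Matrix MvPolynomial

/-- `g ∈ SO(3)` fixes the polynomial `q`, i.e. `q(g⁻¹·x) = q(x)` for all `x`. -/
def fixesPoly (g : Matrix (Fin 3) (Fin 3) ℝ) (q : MvPolynomial (Fin 3) ℝ) : Prop :=
  ∀ x : Fin 3 → ℝ, eval (g⁻¹.mulVec x) q = eval x q

/-- The symmetric matrix `d₂(p)ᵢⱼ = Σ_{k,l,m} (∂ₖ∂ₗ∂ₘ∂ᵢ p)·(∂ₖ∂ₗ∂ₘ∂ⱼ p)`, realizing
`d₂ = tr₁₃(H²)` up to a positive factor. -/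
noncomputable def d2 (p : MvPolynomial (Fin 3) ℝ) : Matrix (Fin 3) (Fin 3) ℝ :=
  Matrix.of fun i j => ∑ k, ∑ l, ∑ m,
    (eval 0 (pderiv k (pderiv l (pderiv m (pderiv i p))))) *
    (eval 0 (pderiv k (pderiv l (pderiv m (pderiv j p)))))

/-- A homogeneous polynomial of degree `n + 1` over `ℝ` with vanishing gradient is zero. -/
lemma MvPolynomial.IsHomogeneous.eq_zero_of_pderiv_eq_zero {σ : Type*} [Fintype σ]
    {q : MvPolynomial σ ℝ} {n : ℕ} (hq : q.IsHomogeneous (n + 1)) (h : ∀ i, pderiv i q = 0) : q = 0 := by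
  have euler := hq.sum_X_mul_pderiv
  simp only [h, mul_zero, Finset.sum_const_zero] at euler
  exact (smul_eq_zero.mp euler.symm).resolve_left n.succ_ne_zero

lemma MvPolynomial.IsHomogeneous.eq_zero_of_eval_zero {σ R : Type*} [CommSemiring R]
    {q : MvPolynomial σ R} (hq : q.IsHomogeneous 0) (h : eval 0 q = 0) : q = 0 := by
  rw [← totalDegree_zero_iff_isHomogeneous, totalDegree_eq_zero_iff_eq_C] at hq
  rw [hq] at h ⊢
  simpa using h

lemma eq_zero_of_d2_eq_zero {p : MvPolynomial (Fin 3) ℝ} (hp : p.IsHomogeneous 4)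
    (h : d2 p = 0) : p = 0 := by
  have key : ∀ i k l m, eval 0 (pderiv k (pderiv l (pderiv m (pderiv i p)))) = 0 := by
    intro i
    have hi : d2 p i i = 0 := by simp [h]
    simp only [d2, Matrix.of_apply] at hi
    have h0 (k l m) := mul_self_nonneg (eval 0 (pderiv k (pderiv l (pderiv m (pderiv i p)))))
    intro k l m
    rw [Finset.sum_eq_zero_iff_of_nonneg fun k _ => Finset.sum_nonneg fun l _ =>
      Finset.sum_nonneg fun m _ => h0 k l m] at hi
    have hk := hi k (Finset.mem_univ _)
    rw [Finset.sum_eq_zero_iff_of_nonneg fun l _ => Finset.sum_nonneg fun m _ => h0 k l m] at hk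
    have hl := hk l (Finset.mem_univ _)
    rw [Finset.sum_eq_zero_iff_of_nonneg fun m _ => h0 k l m] at hl
    exact mul_self_eq_zero.mp (hl m (Finset.mem_univ _))
  refine hp.eq_zero_of_pderiv_eq_zero fun i => ?_
  refine hp.pderiv.eq_zero_of_pderiv_eq_zero fun m => ?_
  refine hp.pderiv.pderiv.eq_zero_of_pderiv_eq_zero fun l => ?_
  refine hp.pderiv.pderiv.pderiv.eq_zero_of_pderiv_eq_zero fun k => ?_
  exact hp.pderiv.pderiv.pderiv.pderiv.eq_zero_of_eval_zero (key i k l m)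

lemma MvPolynomial.IsHomogeneous.eval_smul {σ R : Type*} [Fintype σ] [CommSemiring R]
    {q : MvPolynomial σ R} {n : ℕ} (hq : q.IsHomogeneous n) (r : R) (x : σ → R) :
    eval (r • x) q = r ^ n * eval x q := by
  rw [eval_eq', eval_eq', Finset.mul_sum]
  refine Finset.sum_congr rfl fun d hd => ?_
  have hdeg : ∑ i, d i = n := by
    simpa [Finsupp.weight_apply, Finsupp.sum_fintype] using hq (mem_support_iff.mp hd)
  simp only [Pi.smul_apply, smul_eq_mul, mul_pow, Finset.prod_mul_distrib,
    Finset.prod_pow_eq_pow_sum, hdeg]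
  ring

/-- A traceless matrix fixed under conjugation by all rotations is zero. -/
lemma eq_zero_of_forall_SO3_conj {a : Matrix (Fin 3) (Fin 3) ℝ} (ha : a.trace = 0)
    (h : ∀ g ∈ SO3, g * a * gᵀ = a) : a = 0 := by
  have hx := h !![1, 0, 0; 0, -1, 0; 0, 0, -1] (by
    constructor
    · ext i j
      fin_cases i <;> fin_cases j <;> simp [Matrix.mul_apply, Fin.sum_univ_three]
    · simp [Matrix.det_fin_three])
  have hz := h !![-1, 0, 0; 0, -1, 0; 0, 0, 1] (by
    constructor
    · ext i j
      fin_cases i <;> fin_cases j <;> simp [Matrix.mul_apply, Fin.sum_univ_three]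
    · simp [Matrix.det_fin_three])
  have hc := h !![0, 1, 0; 0, 0, 1; 1, 0, 0] (by
    constructor
    · ext i j
      fin_cases i <;> fin_cases j <;> simp [Matrix.mul_apply, Fin.sum_univ_three]
    · simp [Matrix.det_fin_three])
  have ex (i j) := congrFun₂ hx i j
  have ez (i j) := congrFun₂ hz i j
  have ec (i j) := congrFun₂ hc i j
  simp only [Matrix.mul_apply, Fin.sum_univ_three, Fin.forall_fin_succ, Matrix.transpose_apply,
    Matrix.trace, Matrix.diag_apply] at ex ez ec ha
  simp at ex ez ec
  ext i j
  fin_cases i <;> fin_cases j <;> simp <;> linarith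

/-- A plane vector can be rotated onto the first axis. -/
lemma exists_rotation_to_axis (x y : ℝ) :
    ∃ c s r : ℝ, c ^ 2 + s ^ 2 = 1 ∧ c * x + s * y = r ∧ -s * x + c * y = 0 := by
  by_cases h : x ^ 2 + y ^ 2 = 0
  · have hy : y = 0 := by nlinarith [sq_nonneg x, sq_nonneg y]
    exact ⟨1, 0, x, by simp, by simp, by simp [hy]⟩
  · have hr : √(x ^ 2 + y ^ 2) ≠ 0 := by
      rw [Real.sqrt_ne_zero']
      positivity
    have hsq : √(x ^ 2 + y ^ 2) ^ 2 = x ^ 2 + y ^ 2 := Real.sq_sqrt (by positivity)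
    refine ⟨x / √(x ^ 2 + y ^ 2), y / √(x ^ 2 + y ^ 2), _, ?_, rfl, by ring⟩
    rw [div_pow, div_pow, hsq, ← add_div, div_self h]

lemma eval_mulVec_of_fixesPoly {p : MvPolynomial (Fin 3) ℝ} (h : ∀ g ∈ SO3, fixesPoly g p)
    {g : Matrix (Fin 3) (Fin 3) ℝ} (hg : g ∈ SO3) (x : Fin 3 → ℝ) :
    eval (g *ᵥ x) p = eval x p := by
  have := h g hg (g *ᵥ x)
  rwa [Matrix.mulVec_mulVec, Matrix.nonsing_inv_mul _ (by simp [hg.2]), Matrix.one_mulVec,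
    eq_comm] at this

/-- A homogeneous quartic invariant under all rotations is a multiple of `(x² + y² + z²)²`. -/
lemma eq_C_mul_of_fixesPoly {p : MvPolynomial (Fin 3) ℝ} (hp : p.IsHomogeneous 4)
    (h : ∀ g ∈ SO3, fixesPoly g p) :
    p = C (eval ![1, 0, 0] p) * (X 0 ^ 2 + X 1 ^ 2 + X 2 ^ 2) ^ 2 := by
  refine MvPolynomial.funext fun x => ?_
  obtain ⟨c, s, r, hcs, hr, hr0⟩ := exists_rotation_to_axis (x 0) (x 1)
  obtain ⟨c', s', R, hcs', hR, hR0⟩ := exists_rotation_to_axis r (x 2)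
  have hg : !![c, s, 0; -s, c, 0; 0, 0, 1] ∈ SO3 := by
    constructor
    · ext i j
      fin_cases i <;> fin_cases j <;> simp [Matrix.mul_apply, Fin.sum_univ_three] <;> linarith
    · simp [Matrix.det_fin_three]
      linarith
  have hg' : !![c', 0, s'; 0, 1, 0; -s', 0, c'] ∈ SO3 := by
    constructor
    · ext i j
      fin_cases i <;> fin_cases j <;> simp [Matrix.mul_apply, Fin.sum_univ_three] <;> linarith
    · simp [Matrix.det_fin_three]
      linarith
  have hv : !![c', 0, s'; 0, 1, 0; -s', 0, c'] *ᵥ !![c, s, 0; -s, c, 0; 0, 0, 1] *ᵥ x =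
      R • ![1, 0, 0] := by
    ext i
    fin_cases i <;> simp [Matrix.mulVec, dotProduct, Fin.sum_univ_three, hr] <;> linarith
  have hr2 : r ^ 2 = x 0 ^ 2 + x 1 ^ 2 := by
    linear_combination (x 0 ^ 2 + x 1 ^ 2) * hcs - (c * x 0 + s * x 1 + r) * hr -
      (-s * x 0 + c * x 1) * hr0
  have hR2 : R ^ 2 = r ^ 2 + x 2 ^ 2 := by
    linear_combination (r ^ 2 + x 2 ^ 2) * hcs' - (c' * r + s' * x 2 + R) * hR -
      (-s' * r + c' * x 2) * hR0
  rw [← eval_mulVec_of_fixesPoly h hg, ← eval_mulVec_of_fixesPoly h hg', hv, hp.eval_smul]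
  simp only [map_mul, map_pow, map_add, eval_C, eval_X, ← hr2, ← hR2]
  ring

lemma eq_zero_of_fixesPoly_of_lap_eq_zero {p : MvPolynomial (Fin 3) ℝ} (hp : p.IsHomogeneous 4)
    (hharm : lap p = 0) (h : ∀ g ∈ SO3, fixesPoly g p) : p = 0 := by
  have hpc := eq_C_mul_of_fixesPoly hp h
  generalize eval ![1, 0, 0] p = c at hpc
  subst hpc
  have := congrArg (eval ![1, 0, 0]) hharm
  have h2 : pderiv 0 (2 : MvPolynomial (Fin 3) ℝ) = 0 := (pderiv 0).map_natCast 2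
  simp [lap, Fin.sum_univ_three, pderiv_X, Pi.single_apply, h2] at this
  have hc : c = 0 := by linarith
  simp [hc]

/-- Let `E = (H, a, b, λ, μ)` be the harmonic decomposition of an
elasticity tensor, with `H` represented by a harmonic homogeneous degree-4 polynomial `p`,
`a`, `b` traceless symmetric matrices and `λ`, `μ` scalars. Then `E` is isotropic (every
rotation fixes `p`, `a` and `b`) iff `a = 0`, `b = 0` and `d₂(p) = 0`. -/
theorem elasticity_isotropic_iff
    (p : MvPolynomial (Fin 3) ℝ) (hp : p.IsHomogeneous 4) (hharm : lap p = 0)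
    (a b : Matrix (Fin 3) (Fin 3) ℝ) (ha : aᵀ = a) (hb : bᵀ = b)
    (ha0 : a.trace = 0) (hb0 : b.trace = 0) (lam mu : ℝ) :
    (∀ g ∈ SO3, fixesPoly g p ∧ g * a * gᵀ = a ∧ g * b * gᵀ = b) ↔
      (a = 0 ∧ b = 0 ∧ d2 p = 0) := by
  constructor
  · intro h
    refine ⟨eq_zero_of_forall_SO3_conj ha0 fun g hg => (h g hg).2.1,
      eq_zero_of_forall_SO3_conj hb0 fun g hg => (h g hg).2.2, ?_⟩
    rw [eq_zero_of_fixesPoly_of_lap_eq_zero hp hharm fun g hg => (h g hg).1]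
    ext i j
    simp [d2]
  · rintro ⟨rfl, rfl, h⟩ g -
    rw [eq_zero_of_d2_eq_zero hp h]
    simp [fixesPoly]
end
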